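/- arXiv:1510.07824 — 2 statements merged into one kernel-verified Lean document; each statement's English description precedes it below -/
import Mathlib

section
/- Let σ be a complex number with Re σ < 0, and let T⁻²(r,s) = (1/6)(r²s - r⁴/(5s))·θ(s-r) + (1/6)(s²r - s⁴/(5r))·θ(r-s). Then for every r > 0 the integral ∫₀^∞ T⁻²(r,s)·(σ e^{σ s} - e^{σ s}/s) ds converges and equals σ^{-4}·(σ e^{σ r} - (e^{σ r} - 1)/r) - r/(2σ²). -/
open MeasureTheory

/-- The Heaviside step function (with the symmetric convention `θ(0) = 1/2`). -/
noncomputable def heaviside (x : ℝ) : ℝ := if x < 0 then 0 else if x = 0 then 1 / 2 else 1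

/-- The kernel `T⁻²(r,s) = (1/6)(r²s - r⁴/(5s)) θ(s-r) + (1/6)(s²r - s⁴/(5r)) θ(r-s)`. -/
noncomputable def Tinv2 (r s : ℝ) : ℝ :=
  (1 / 6) * (r ^ 2 * s - r ^ 4 / (5 * s)) * heaviside (s - r)
    + (1 / 6) * (s ^ 2 * r - s ^ 4 / (5 * r)) * heaviside (r - s)

open Filter Topology in
lemma aux_pow (τ : ℂ) (h : τ.re < 0) (n : ℕ) :
    Tendsto (fun s : ℝ => (s : ℂ) ^ n * Complex.exp (τ * s)) atTop (𝓝 0) := by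
  rw [tendsto_zero_iff_norm_tendsto_zero]
  have := tendsto_rpow_mul_exp_neg_mul_atTop_nhds_zero n (-τ.re) (by linarith)
  refine this.congr' ?_
  filter_upwards [eventually_gt_atTop 0] with s hs
  simp [Complex.norm_exp, abs_of_pos hs]

open Filter Topology in
lemma aux_inv : Tendsto (fun s : ℝ => ((s : ℂ))⁻¹) atTop (𝓝 0) := by
  have := (Complex.continuous_ofReal.tendsto 0).comp tendsto_inv_atTop_zero
  simpa [Function.comp_def] using this

lemma aux_exp (σ : ℂ) (s : ℝ) :
    HasDerivAt (fun s : ℝ => Complex.exp (σ * s)) (Complex.exp (σ * s) * σ) s := by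
  have h : HasDerivAt (fun z : ℂ => Complex.exp (σ * z)) (Complex.exp (σ * s) * σ) (s : ℂ) := by
    simpa using ((hasDerivAt_id (s : ℂ)).const_mul σ).cexp
  exact h.comp_ofReal

open Filter Topology in
lemma aux_outer (σ : ℂ) (hσ : σ.re < 0) (r : ℝ) (hr : 0 < r) :
    IntegrableOn (fun s : ℝ => ((1 / 6 : ℂ) * (r ^ 2 * s - r ^ 4 / (5 * s))) *
      (σ * Complex.exp (σ * s) - Complex.exp (σ * s) / s)) (Set.Ioi r) ∧
    ∫ s in Set.Ioi r, ((1 / 6 : ℂ) * (r ^ 2 * s - r ^ 4 / (5 * s))) *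
      (σ * Complex.exp (σ * s) - Complex.exp (σ * s) / s) =
      - ((1 / 6 : ℂ) * (r ^ 2 * (r - 2 / σ) - r ^ 4 / 5 * (r : ℂ)⁻¹) * Complex.exp (σ * r)) := by
  have hσ0 : σ ≠ 0 := by rintro rfl; simp at hσ
  have hc : ∀ s ∈ Set.Ici r, (s : ℂ) ≠ 0 := fun s hs => by
    have : 0 < s := lt_of_lt_of_le hr hs
    exact_mod_cast this.ne'
  have hint : IntegrableOn (fun s : ℝ => ((1 / 6 : ℂ) * (r ^ 2 * s - r ^ 4 / (5 * s))) *
      (σ * Complex.exp (σ * s) - Complex.exp (σ * s) / s)) (Set.Ioi r) := by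
    have hcont : ContinuousOn (fun s : ℝ => ((1 / 6 : ℂ) * (r ^ 2 * s - r ^ 4 / (5 * s))) *
        (σ * Complex.exp (σ * s) - Complex.exp (σ * s) / s)) (Set.Ici r) := by
      intro s hs
      have h0 := hc s hs
      have h5 : (5 * (s : ℂ)) ≠ 0 := by simpa using h0
      apply ContinuousAt.continuousWithinAt
      fun_prop (disch := assumption)
    refine (integrable_norm_iff ((hcont.mono Set.Ioi_subset_Ici_self).aestronglyMeasurable
      measurableSet_Ioi)).1 ?_
    refine integrable_of_isBigO_exp_neg (b := -(σ / 2).re) (by simp; linarith) hcont.norm ?_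
    · have hre : (σ / 2).re < 0 := by simp; linarith
      have h1 := aux_pow (σ / 2) hre 1
      have h0 := aux_pow (σ / 2) hre 0
      have hi := aux_inv
      have ht : Tendsto (fun s : ℝ => (1 / 6 : ℂ) * (r ^ 2 * σ * ((s : ℂ) ^ 1 * Complex.exp (σ / 2 * s))
          - r ^ 2 * ((s : ℂ) ^ 0 * Complex.exp (σ / 2 * s))
          - r ^ 4 / 5 * (s : ℂ)⁻¹ * (σ - (s : ℂ)⁻¹) * ((s : ℂ) ^ 0 * Complex.exp (σ / 2 * s)))) atTop
          (𝓝 ((1 / 6 : ℂ) * (r ^ 2 * σ * 0 - r ^ 2 * 0 - r ^ 4 / 5 * 0 * (σ - 0) * 0))) :=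
        (((h1.const_mul _).sub (h0.const_mul _)).sub
          (((hi.const_mul _).mul (hi.const_sub _)).mul h0)).const_mul _
      have hO2 : (fun s : ℝ => ((1 / 6 : ℂ) * (r ^ 2 * s - r ^ 4 / (5 * s))) *
          (σ * Complex.exp (σ * s) - Complex.exp (σ * s) / s)) =O[atTop]
          (fun s : ℝ => ‖Complex.exp (σ / 2 * s)‖) := by
        refine Asymptotics.IsBigO.norm_right ?_
        have hO' := (ht.isBigO_one ℂ).mul
          (Asymptotics.isBigO_refl (fun s : ℝ => Complex.exp (σ / 2 * s)) atTop)
        refine hO'.congr' ?_ ?_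
        · filter_upwards [eventually_ge_atTop r] with s hs
          have h0 := hc s hs
          have he : Complex.exp (σ * s) = Complex.exp (σ / 2 * s) * Complex.exp (σ / 2 * s) := by
            rw [← Complex.exp_add]; congr 1; ring
          rw [he]
          field_simp
        · filter_upwards with s
          simp
      refine hO2.norm_left.congr_right ?_
      intro s
      simp [Complex.norm_exp]
  refine ⟨hint, ?_⟩
  have hd : ∀ s ∈ Set.Ici r, HasDerivAt (fun s : ℝ => (1 / 6 : ℂ) *
      (r ^ 2 * (s - 2 / σ) - r ^ 4 / 5 * (s : ℂ)⁻¹) * Complex.exp (σ * s))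
      (((1 / 6 : ℂ) * (r ^ 2 * s - r ^ 4 / (5 * s))) *
      (σ * Complex.exp (σ * s) - Complex.exp (σ * s) / s)) s := by
    intro s hs
    have h0 := hc s hs
    have hs1 : HasDerivAt (fun s : ℝ => (s : ℂ)) 1 s := (hasDerivAt_id (s : ℂ)).comp_ofReal
    have hs2 : HasDerivAt (fun s : ℝ => (s : ℂ)⁻¹) (-((s : ℂ) ^ 2)⁻¹) s :=
      (hasDerivAt_inv h0).comp_ofReal
    have := (((((hs1.sub_const (2 / σ)).const_mul ((r : ℂ) ^ 2)).sub
      (hs2.const_mul ((r : ℂ) ^ 4 / 5))).const_mul (1 / 6 : ℂ)).mul (aux_exp σ s))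
    refine this.congr_deriv ?_
    simp only [Pi.sub_apply]
    field_simp
    ring
  have hlim : Tendsto (fun s : ℝ => (1 / 6 : ℂ) *
      (r ^ 2 * (s - 2 / σ) - r ^ 4 / 5 * (s : ℂ)⁻¹) * Complex.exp (σ * s)) atTop (𝓝 0) := by
    have h1 := aux_pow σ hσ 1
    have h0 := aux_pow σ hσ 0
    have hi := aux_inv
    have := (((h1.const_mul ((r : ℂ) ^ 2)).sub (h0.const_mul ((r : ℂ) ^ 2 * (2 / σ)))).sub
      ((hi.const_mul ((r : ℂ) ^ 4 / 5)).mul h0)).const_mul (1 / 6 : ℂ)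
    simp only [mul_zero, sub_zero] at this
    refine this.congr ?_
    intro s
    ring
  rw [integral_Ioi_of_hasDerivAt_of_tendsto' hd hint hlim]
  ring

lemma aux_inner (σ : ℂ) (hσ0 : σ ≠ 0) (r : ℝ) (hr : 0 < r) :
    IntegrableOn (fun s : ℝ => (1 / 6 : ℂ) * (r * (σ * s ^ 2 - s)
      - 1 / (5 * r) * (σ * s ^ 4 - s ^ 3)) * Complex.exp (σ * s)) (Set.Ioc 0 r) ∧
    ∫ s in Set.Ioc 0 r, (1 / 6 : ℂ) * (r * (σ * s ^ 2 - s)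
      - 1 / (5 * r) * (σ * s ^ 4 - s ^ 3)) * Complex.exp (σ * s) =
      (1 / 6 : ℂ) * (r * (r ^ 2 - 3 * (r / σ - 1 / σ ^ 2))
       - 1 / (5 * r) * (r ^ 4 - 5 * (r ^ 3 / σ - 3 * r ^ 2 / σ ^ 2 + 6 * r / σ ^ 3 - 6 / σ ^ 4)))
       * Complex.exp (σ * r) - (r / (2 * σ ^ 2) - 1 / (r * σ ^ 4)) := by
  have hr0 : (r : ℂ) ≠ 0 := by exact_mod_cast hr.ne'
  have hcont : Continuous (fun s : ℝ => (1 / 6 : ℂ) * (r * (σ * s ^ 2 - s)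
      - 1 / (5 * r) * (σ * s ^ 4 - s ^ 3)) * Complex.exp (σ * s)) := by fun_prop
  refine ⟨(hcont.integrableOn_Icc).mono_set Set.Ioc_subset_Icc_self, ?_⟩
  rw [← intervalIntegral.integral_of_le hr.le]
  have hd : ∀ s ∈ Set.uIcc 0 r, HasDerivAt (fun s : ℝ => (1 / 6 : ℂ) *
      (r * (s ^ 2 - 3 * (s / σ - 1 / σ ^ 2))
       - 1 / (5 * r) * (s ^ 4 - 5 * (s ^ 3 / σ - 3 * s ^ 2 / σ ^ 2 + 6 * s / σ ^ 3 - 6 / σ ^ 4)))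
       * Complex.exp (σ * s)) ((1 / 6 : ℂ) * (r * (σ * s ^ 2 - s)
      - 1 / (5 * r) * (σ * s ^ 4 - s ^ 3)) * Complex.exp (σ * s)) s := by
    intro s _
    have hp : ∀ n : ℕ, HasDerivAt (fun s : ℝ => (s : ℂ) ^ n) (n * (s : ℂ) ^ (n - 1)) s :=
      fun n => (hasDerivAt_pow n (s : ℂ)).comp_ofReal
    have hs1 : HasDerivAt (fun s : ℝ => (s : ℂ)) 1 s := (hasDerivAt_id (s : ℂ)).comp_ofReal
    have h1 := ((hp 2).sub (((hs1.div_const σ).sub_const (1 / σ ^ 2)).const_mul 3)).const_mul (r : ℂ)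
    have h2 := ((hp 4).sub ((((((hp 3).div_const σ).sub (((hp 2).const_mul 3).div_const (σ ^ 2))).add
      ((hs1.const_mul 6).div_const (σ ^ 3))).sub_const (6 / σ ^ 4)).const_mul 5)).const_mul
        (1 / (5 * (r : ℂ)))
    have := ((h1.sub h2).const_mul (1 / 6 : ℂ)).mul (aux_exp σ s)
    refine this.congr_deriv ?_
    simp only [Pi.sub_apply, Pi.add_apply]
    push_cast
    field_simp
    ring
  rw [intervalIntegral.integral_eq_sub_of_hasDerivAt hd (hcont.intervalIntegrable _ _)]
  simp only [Complex.ofReal_zero, mul_zero, Complex.exp_zero]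
  congr 1
  field_simp
  ring

/-- For complex `σ` with `Re σ < 0` and every `r > 0`, the integral
`∫₀^∞ T⁻²(r,s) (σ e^{σs} - e^{σs}/s) ds` converges and equals
`σ⁻⁴ (σ e^{σr} - (e^{σr}-1)/r) - r/(2σ²)`. -/
theorem stmt16 (σ : ℂ) (hσ : σ.re < 0) :
    ∀ r ∈ Set.Ioi (0 : ℝ),
      IntegrableOn
        (fun s : ℝ => (Tinv2 r s : ℂ) * (σ * Complex.exp (σ * s) - Complex.exp (σ * s) / s))
        (Set.Ioi 0) ∧
      (∫ s in Set.Ioi (0 : ℝ),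
          (Tinv2 r s : ℂ) * (σ * Complex.exp (σ * s) - Complex.exp (σ * s) / s))
        = σ ^ (-4 : ℤ) * (σ * Complex.exp (σ * r) - (Complex.exp (σ * r) - 1) / r)
          - r / (2 * σ ^ 2) := by
  intro r hr
  have hr : 0 < r := hr
  have hσ0 : σ ≠ 0 := by rintro rfl; simp at hσ
  have hr0 : (r : ℂ) ≠ 0 := by exact_mod_cast hr.ne'
  obtain ⟨hi2, he2⟩ := aux_outer σ hσ r hr
  obtain ⟨hi1, he1⟩ := aux_inner σ hσ0 r hr
  set f : ℝ → ℂ := fun s : ℝ =>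
    (Tinv2 r s : ℂ) * (σ * Complex.exp (σ * s) - Complex.exp (σ * s) / s) with hf
  have e2 : Set.EqOn (fun s : ℝ => ((1 / 6 : ℂ) * (r ^ 2 * s - r ^ 4 / (5 * s))) *
      (σ * Complex.exp (σ * s) - Complex.exp (σ * s) / s)) f (Set.Ioi r) := by
    intro s hs
    have hs : r < s := hs
    have a1 : ¬ (s - r < 0) := by linarith
    have a2 : ¬ (s - r = 0) := by intro h; linarith
    have a3 : r - s < 0 := by linarith
    simp only [hf, Tinv2, heaviside, a1, a2, a3, if_true, if_false]
    push_cast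
    ring
  have e1 : Set.EqOn (fun s : ℝ => (1 / 6 : ℂ) * (r * (σ * s ^ 2 - s)
      - 1 / (5 * r) * (σ * s ^ 4 - s ^ 3)) * Complex.exp (σ * s)) f (Set.Ioc 0 r) := by
    intro s hs
    have hs0 : (s : ℂ) ≠ 0 := by exact_mod_cast hs.1.ne'
    rcases hs.2.lt_or_eq with h | h
    · have a1 : ¬ (r - s < 0) := by linarith
      have a2 : ¬ (r - s = 0) := by intro h; linarith
      have a3 : s - r < 0 := by linarith
      simp only [hf, Tinv2, heaviside, a1, a2, a3, if_true, if_false]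
      push_cast
      field_simp
      ring
    · subst h
      simp only [hf, Tinv2, heaviside, sub_self, lt_irrefl, if_true, if_false]
      push_cast
      field_simp
      ring
  have j2 := hi2.congr_fun e2 measurableSet_Ioi
  have j1 := hi1.congr_fun e1 measurableSet_Ioc
  rw [setIntegral_congr_fun measurableSet_Ioi e2] at he2
  rw [setIntegral_congr_fun measurableSet_Ioc e1] at he1
  rw [← Set.Ioc_union_Ioi_eq_Ioi hr.le]
  refine ⟨j1.union j2, ?_⟩
  rw [setIntegral_union (Set.Ioc_disjoint_Ioi le_rfl) measurableSet_Ioi j1 j2, he1, he2]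
  rw [show (σ ^ (-4 : ℤ)) = 1 / σ ^ 4 by rw [zpow_neg, one_div]; rfl]
  field_simp
  ring
end

section
/- Let ρ > 0, and for either choice of sign set σ₁ = e^{∓5iπ/8}ρ and σ₂ = e^{∓9iπ/8}ρ, and define d(r) = (σ₁ e^{σ₁ r} - e^{σ₁ r}/r) - (σ₂ e^{σ₂ r} - e^{σ₂ r}/r) for r > 0. Then both integrals below converge and ∫₀^∞ d(r)/r dr = √2 · e^{±5iπ/8} · ρ and ∫₀^∞ r² d(r) dr = 6 · e^{±iπ/4} · ρ^{-2}. -/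
open MeasureTheory

lemma aux_norm (σ : ℂ) (n : ℕ) (r : ℝ) (hr : 0 < r) :
    ‖(r : ℂ) ^ n * Complex.exp (σ * r)‖ = r ^ (n : ℝ) * Real.exp (-(-σ.re) * r) := by
  rw [norm_mul, Complex.norm_exp, norm_pow, Complex.norm_real, Real.norm_of_nonneg hr.le,
    Real.rpow_natCast]
  simp

lemma aux_int (σ : ℂ) (h : σ.re < 0) (n : ℕ) :
    IntegrableOn (fun r : ℝ => (r : ℂ) ^ n * Complex.exp (σ * r)) (Set.Ioi 0) := by
  have h1 := integrableOn_rpow_mul_exp_neg_mul_rpow (p := 1) (s := (n : ℝ)) (b := -σ.re)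
    (by have : (0 : ℝ) ≤ n := n.cast_nonneg
        linarith) one_pos (by linarith)
  refine Integrable.mono' h1 ?_ ?_
  · exact (by fun_prop : Continuous (fun r : ℝ => (r : ℂ) ^ n * Complex.exp (σ * r))).aestronglyMeasurable
  · filter_upwards [ae_restrict_mem measurableSet_Ioi] with r hr
    rw [aux_norm σ n r hr, Real.rpow_one]

lemma aux_lim (σ : ℂ) (h : σ.re < 0) (n : ℕ) :
    Filter.Tendsto (fun r : ℝ => (r : ℂ) ^ n * Complex.exp (σ * r)) Filter.atTop (nhds 0) := by
  rw [tendsto_zero_iff_norm_tendsto_zero]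
  refine (tendsto_rpow_mul_exp_neg_mul_atTop_nhds_zero n (-σ.re) (by linarith)).congr' ?_
  filter_upwards [Filter.eventually_gt_atTop 0] with r hr
  rw [aux_norm σ n r hr]

lemma aux_exp_deriv (σ : ℂ) (r : ℝ) :
    HasDerivAt (fun r : ℝ => Complex.exp (σ * r)) (σ * Complex.exp (σ * r)) r := by
  have h := ((Complex.ofRealCLM.hasDerivAt (x := r)).const_mul σ).cexp
  simpa [mul_comm] using h

lemma aux_second (σ : ℂ) (h : σ.re < 0) :
    IntegrableOn (fun r : ℝ => (r : ℂ) ^ 2 * (σ * Complex.exp (σ * r) - Complex.exp (σ * r) / r))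
      (Set.Ioi 0) ∧
    (∫ r in Set.Ioi (0 : ℝ),
      (r : ℂ) ^ 2 * (σ * Complex.exp (σ * r) - Complex.exp (σ * r) / r)) = - 3 / σ ^ 2 := by
  have hσ : σ ≠ 0 := by rintro rfl; simp at h
  have hi : IntegrableOn (fun r : ℝ => (r : ℂ) ^ 2 *
      (σ * Complex.exp (σ * r) - Complex.exp (σ * r) / r)) (Set.Ioi 0) := by
    refine (((aux_int σ h 2).const_mul σ).sub (aux_int σ h 1)).congr ?_
    filter_upwards [ae_restrict_mem measurableSet_Ioi] with r hr
    have : (r : ℂ) ≠ 0 := by exact_mod_cast (ne_of_gt hr)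
    simp only [Pi.sub_apply]
    field_simp
  refine ⟨hi, ?_⟩
  have hd : ∀ r ∈ Set.Ioi (0 : ℝ), HasDerivAt
      (fun r : ℝ => ((r : ℂ) ^ 2 - 3 * ((r : ℂ) / σ - 1 / σ ^ 2)) * Complex.exp (σ * r))
      ((r : ℂ) ^ 2 * (σ * Complex.exp (σ * r) - Complex.exp (σ * r) / r)) r := by
    intro r hr
    have h0 : (r : ℂ) ≠ 0 := by exact_mod_cast (ne_of_gt hr)
    have hc : HasDerivAt (fun r : ℝ => (r : ℂ)) 1 r := Complex.ofRealCLM.hasDerivAt (x := r)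
    have := ((hc.pow 2).sub (((hc.div_const σ).sub_const (1 / σ ^ 2)).const_mul 3)).mul
      (aux_exp_deriv σ r)
    refine HasDerivAt.congr_deriv this ?_
    simp
    field_simp
    ring
  have ht : Filter.Tendsto
      (fun r : ℝ => ((r : ℂ) ^ 2 - 3 * ((r : ℂ) / σ - 1 / σ ^ 2)) * Complex.exp (σ * r))
      Filter.atTop (nhds 0) := by
    have := ((aux_lim σ h 2).sub ((aux_lim σ h 1).const_mul (3 / σ))).add
      ((aux_lim σ h 0).const_mul (3 / σ ^ 2))
    simp only [mul_zero, sub_zero, add_zero] at this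
    refine this.congr fun r => ?_
    ring
  rw [integral_Ioi_of_hasDerivAt_of_tendsto (Continuous.continuousWithinAt (by fun_prop)) hd hi ht]
  simp
  ring

lemma aux_first (a b : ℂ) (ha : a.re < 0) (hb : b.re < 0) :
    IntegrableOn (fun r : ℝ => ((a * Complex.exp (a * r) - Complex.exp (a * r) / r)
        - (b * Complex.exp (b * r) - Complex.exp (b * r) / r)) / r) (Set.Ioi 0) ∧
    (∫ r in Set.Ioi (0 : ℝ), ((a * Complex.exp (a * r) - Complex.exp (a * r) / r)
        - (b * Complex.exp (b * r) - Complex.exp (b * r) / r)) / r) = b - a := by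
  set f : ℂ → ℂ := fun z => Complex.exp (a * z) - Complex.exp (b * z) with hf
  have hfd : Differentiable ℂ f := by fun_prop
  set G : ℂ → ℂ := dslope f 0 with hG
  have hGd : Differentiable ℂ G := by
    rw [← differentiableOn_univ]
    exact (Complex.differentiableOn_dslope Filter.univ_mem).2 hfd.differentiableOn
  have hG' : Continuous (deriv G) :=
    (hGd.contDiff (n := 1)).continuous_deriv le_rfl
  have hGr : ∀ z : ℂ, z ≠ 0 → G z = f z / z := by
    intro z hz
    rw [hG, dslope_of_ne _ hz, slope_def_field]
    simp [hf]
  have he : ∀ c z : ℂ, HasDerivAt (fun z => Complex.exp (c * z)) (c * Complex.exp (c * z)) z := by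
    intro c z
    simpa [mul_comm] using ((hasDerivAt_id z).const_mul c).cexp
  have hG0 : G 0 = a - b := by
    rw [hG, dslope_same]
    have := ((he a 0).sub (he b 0)).deriv
    refine Eq.trans this ?_
    simp
  have hdG : ∀ r : ℝ, 0 < r → deriv G r = ((a * Complex.exp (a * r) - Complex.exp (a * r) / r)
        - (b * Complex.exp (b * r) - Complex.exp (b * r) / r)) / r := by
    intro r hr
    have h0 : (r : ℂ) ≠ 0 := by exact_mod_cast (ne_of_gt hr)
    have h1 : G =ᶠ[nhds (r : ℂ)] fun z => f z / z := by
      filter_upwards [isOpen_ne.mem_nhds h0] with z hz using hGr z hz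
    rw [h1.deriv_eq]
    have := (((he a r).sub (he b r)).div (hasDerivAt_id (r : ℂ)) h0).deriv
    refine Eq.trans this ?_
    simp
    field_simp
    ring
  have hi : IntegrableOn (fun r : ℝ => deriv G r) (Set.Ioi 0) := by
    rw [← Set.Ioc_union_Ioi_eq_Ioi (zero_le_one (α := ℝ))]
    refine IntegrableOn.union ?_ ?_
    · exact ((hG'.comp Complex.continuous_ofReal).integrableOn_Icc).mono_set
        Set.Ioc_subset_Icc_self
    · have hsub : Set.Ioi (1 : ℝ) ⊆ Set.Ioi 0 := Set.Ioi_subset_Ioi zero_le_one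
      have Ia := ((aux_int a ha 0).mono_set hsub).norm
      have Ib := ((aux_int b hb 0).mono_set hsub).norm
      refine Integrable.mono' ((Ia.const_mul (‖a‖ + 1)).add (Ib.const_mul (‖b‖ + 1)))
        (hG'.comp Complex.continuous_ofReal).aestronglyMeasurable ?_
      filter_upwards [ae_restrict_mem measurableSet_Ioi] with r hr
      have hr1 : (1 : ℝ) < r := hr
      have hr0 : 0 < r := by linarith
      rw [hdG r hr0]
      have key : ∀ c : ℂ, ‖c * Complex.exp (c * r) - Complex.exp (c * r) / r‖
          ≤ (‖c‖ + 1) * ‖Complex.exp (c * r)‖ := by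
        intro c
        refine (norm_sub_le _ _).trans ?_
        rw [norm_mul, norm_div, Complex.norm_real, Real.norm_of_nonneg hr0.le, add_mul, one_mul]
        gcongr
        exact div_le_self (norm_nonneg _) hr1.le
      rw [norm_div, Complex.norm_real, Real.norm_of_nonneg hr0.le]
      refine (div_le_self (norm_nonneg _) hr1.le).trans ?_
      refine (norm_sub_le _ _).trans ?_
      simpa using add_le_add (key a) (key b)
  have heq : Set.EqOn (fun r : ℝ => deriv G r)
      (fun r : ℝ => ((a * Complex.exp (a * r) - Complex.exp (a * r) / r)
        - (b * Complex.exp (b * r) - Complex.exp (b * r) / r)) / r) (Set.Ioi 0) :=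
    fun r hr => hdG r hr
  refine ⟨hi.congr_fun heq measurableSet_Ioi, ?_⟩
  rw [← setIntegral_congr_fun measurableSet_Ioi heq]
  have ht : Filter.Tendsto (fun r : ℝ => G r) Filter.atTop (nhds 0) := by
    have h1 := (aux_lim a ha 0).sub (aux_lim b hb 0)
    have h2 : Filter.Tendsto (fun r : ℝ => ((r⁻¹ : ℝ) : ℂ)) Filter.atTop (nhds ((0 : ℝ) : ℂ)) :=
      (Complex.continuous_ofReal.tendsto 0).comp tendsto_inv_atTop_zero
    have h3 := h1.mul h2
    simp only [sub_zero, zero_mul] at h3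
    refine h3.congr' ?_
    filter_upwards [Filter.eventually_gt_atTop 0] with r hr
    rw [hGr r (by exact_mod_cast (ne_of_gt hr))]
    simp [hf, div_eq_mul_inv]
  rw [integral_Ioi_of_hasDerivAt_of_tendsto (f := fun r : ℝ => G r)
    (Continuous.continuousWithinAt (hGd.continuous.comp Complex.continuous_ofReal))
    (fun r _ => (hGd (r : ℂ)).hasDerivAt.comp_ofReal) hi ht]
  simp [hG0]

lemma aux_re (ρ ε t : ℝ) (hρ : 0 < ρ) (hε : ε = 1 ∨ ε = -1) (h1 : Real.pi / 2 < t)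
    (h2 : t < Real.pi + Real.pi / 2) (σ : ℂ)
    (hσ : σ = Complex.exp (-(ε : ℂ) * t * Complex.I) * ρ) : σ.re < 0 := by
  have h : σ.re = Real.cos t * ρ := by
    rw [hσ, Complex.re_mul_ofReal]
    have : -(ε : ℂ) * t * Complex.I = ((-ε * t : ℝ) : ℂ) * Complex.I := by push_cast; ring
    rw [this, Complex.exp_ofReal_mul_I_re]
    rcases hε with rfl | rfl <;> simp
  rw [h]
  exact mul_neg_of_neg_of_pos (Real.cos_neg_of_pi_div_two_lt_of_lt h1 (by linarith)) hρ

lemma aux_i (ε : ℝ) (hε : ε = 1 ∨ ε = -1) :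
    Complex.exp ((ε : ℂ) * (Real.pi / 2) * Complex.I) = ε * Complex.I := by
  rcases hε with rfl | rfl
  · simp [Complex.exp_pi_div_two_mul_I]
  · have : (((-1 : ℝ) : ℂ)) * (Real.pi / 2) * Complex.I = -(Real.pi / 2 * Complex.I) := by
      push_cast; ring
    rw [this, Complex.exp_neg, Complex.exp_pi_div_two_mul_I]
    simp

lemma aux_q (ε : ℝ) (hε : ε = 1 ∨ ε = -1) :
    Real.sqrt 2 * Complex.exp ((ε : ℂ) * (Real.pi / 4) * Complex.I) = 1 + ε * Complex.I := by
  have h : Complex.exp ((ε : ℂ) * (Real.pi / 4) * Complex.I)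
      = ((Real.sqrt 2 / 2 : ℝ) : ℂ) + ε * ((Real.sqrt 2 / 2 : ℝ) : ℂ) * Complex.I := by
    have : (ε : ℂ) * (Real.pi / 4) * Complex.I = ((ε * (Real.pi / 4) : ℝ) : ℂ) * Complex.I := by
      push_cast; ring
    rw [this, Complex.exp_mul_I, ← Complex.ofReal_cos, ← Complex.ofReal_sin]
    rcases hε with rfl | rfl <;> simp
  have h2 : ((Real.sqrt 2 : ℝ) : ℂ) * (Real.sqrt 2 : ℝ) = 2 := by
    rw [← Complex.ofReal_mul, Real.mul_self_sqrt (by norm_num)]; norm_num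
  rw [h]
  push_cast
  linear_combination (1 / 2 + ε * Complex.I / 2) * h2

/-- Let `ρ > 0` and, for either sign choice (encoded by `ε = ±1`),
`σ₁ = e^{-ε·5iπ/8} ρ`, `σ₂ = e^{-ε·9iπ/8} ρ` and
`d(r) = D e^{σ₁ r} - D e^{σ₂ r}`. Then both integrals converge and
`∫₀^∞ d(r)/r dr = √2 e^{ε·5iπ/8} ρ` and `∫₀^∞ r² d(r) dr = 6 e^{ε·iπ/4} ρ⁻²`. -/
theorem stmt17 (ρ ε : ℝ) (hρ : 0 < ρ) (hε : ε = 1 ∨ ε = -1)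
    (σ₁ σ₂ : ℂ)
    (hσ₁ : σ₁ = Complex.exp (-(ε : ℂ) * (5 * Real.pi / 8) * Complex.I) * ρ)
    (hσ₂ : σ₂ = Complex.exp (-(ε : ℂ) * (9 * Real.pi / 8) * Complex.I) * ρ)
    (d : ℝ → ℂ)
    (hd : ∀ r : ℝ, d r = (σ₁ * Complex.exp (σ₁ * r) - Complex.exp (σ₁ * r) / r)
        - (σ₂ * Complex.exp (σ₂ * r) - Complex.exp (σ₂ * r) / r)) :
    IntegrableOn (fun r : ℝ => d r / r) (Set.Ioi 0) ∧
    (∫ r in Set.Ioi (0 : ℝ), d r / r)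
      = Real.sqrt 2 * Complex.exp ((ε : ℂ) * (5 * Real.pi / 8) * Complex.I) * ρ ∧
    IntegrableOn (fun r : ℝ => (r : ℂ) ^ 2 * d r) (Set.Ioi 0) ∧
    (∫ r in Set.Ioi (0 : ℝ), (r : ℂ) ^ 2 * d r)
      = 6 * Complex.exp ((ε : ℂ) * (Real.pi / 4) * Complex.I) * (ρ : ℂ) ^ (-2 : ℤ) := by
  have hpi := Real.pi_pos
  have r1 : σ₁.re < 0 := aux_re ρ ε (5 * Real.pi / 8) hρ hε (by linarith) (by linarith) σ₁
    (by rw [hσ₁]; push_cast; rfl)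
  have r2 : σ₂.re < 0 := aux_re ρ ε (9 * Real.pi / 8) hρ hε (by linarith) (by linarith) σ₂
    (by rw [hσ₂]; push_cast; rfl)
  obtain ⟨i1, e1⟩ := aux_first σ₁ σ₂ r1 r2
  obtain ⟨i2, e2⟩ := aux_second σ₁ r1
  obtain ⟨i3, e3⟩ := aux_second σ₂ r2
  have hρ0 : (ρ : ℂ) ≠ 0 := by exact_mod_cast hρ.ne'
  have hε2 : (ε : ℂ) * ε = 1 := by rcases hε with rfl | rfl <;> simp
  have hpiI : Complex.exp ((ε : ℂ) * Real.pi * Complex.I) = -1 := by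
    have : (ε : ℂ) * Real.pi * Complex.I = (ε : ℂ) * (Real.pi / 2) * Complex.I
      + (ε : ℂ) * (Real.pi / 2) * Complex.I := by ring
    rw [this, Complex.exp_add, aux_i ε hε]
    linear_combination Complex.I * Complex.I * hε2 + Complex.I_mul_I
  have hd1 : (fun r : ℝ => (r : ℂ) ^ 2 * d r) = fun r : ℝ =>
      (r : ℂ) ^ 2 * (σ₁ * Complex.exp (σ₁ * r) - Complex.exp (σ₁ * r) / r) -
      (r : ℂ) ^ 2 * (σ₂ * Complex.exp (σ₂ * r) - Complex.exp (σ₂ * r) / r) := by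
    funext r; rw [hd]; ring
  have hd2 : (fun r : ℝ => d r / r) = fun r : ℝ =>
      ((σ₁ * Complex.exp (σ₁ * r) - Complex.exp (σ₁ * r) / r)
        - (σ₂ * Complex.exp (σ₂ * r) - Complex.exp (σ₂ * r) / r)) / r := by
    funext r; rw [hd]
  have s2 : σ₂ = -(ε * Complex.I) * σ₁ := by
    have : -(ε : ℂ) * (9 * Real.pi / 8) * Complex.I = -(ε : ℂ) * (5 * Real.pi / 8) * Complex.I
        + (-((ε : ℂ) * Real.pi * Complex.I) + (ε : ℂ) * (Real.pi / 2) * Complex.I) := by ring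
    rw [hσ₂, hσ₁, this, Complex.exp_add, Complex.exp_add, Complex.exp_neg, hpiI, aux_i ε hε]
    norm_num
    ring
  rw [hd1, hd2]
  refine ⟨i1, ?_, i2.sub i3, ?_⟩
  · rw [e1]
    have : (ε : ℂ) * (5 * Real.pi / 8) * Complex.I = (ε : ℂ) * (Real.pi / 4) * Complex.I
      + ((ε : ℂ) * Real.pi * Complex.I + -(ε : ℂ) * (5 * Real.pi / 8) * Complex.I) := by ring
    rw [this, Complex.exp_add, ← mul_assoc, aux_q ε hε, Complex.exp_add, hpiI, s2, hσ₁]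
    ring
  · rw [integral_sub i2 i3, e2, e3, s2]
    have hs0 : σ₁ ≠ 0 := by rintro rfl; simp at r1
    have hsq : (-(ε * Complex.I) * σ₁) ^ 2 = - σ₁ ^ 2 := by
      linear_combination σ₁ ^ 2 * Complex.I * Complex.I * hε2 + σ₁ ^ 2 * Complex.I_mul_I
    have hm : Complex.exp ((ε : ℂ) * (Real.pi / 4) * Complex.I) * σ₁ ^ 2 = - (ρ : ℂ) ^ 2 := by
      rw [hσ₁, mul_pow, ← Complex.exp_nat_mul, ← mul_assoc, ← Complex.exp_add]
      have : (ε : ℂ) * (Real.pi / 4) * Complex.I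
          + ((2 : ℕ) : ℂ) * (-(ε : ℂ) * (5 * Real.pi / 8) * Complex.I)
          = -((ε : ℂ) * Real.pi * Complex.I) := by push_cast; ring
      rw [this, Complex.exp_neg, hpiI]
      norm_num
    rw [hsq, zpow_neg]
    generalize Complex.exp ((ε : ℂ) * (Real.pi / 4) * Complex.I) = E at hm ⊢
    norm_cast
    push_cast
    field_simp
    linear_combination (-6) * hm
end
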